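/- Let f, g_1,…,g_r ∈ ℝ[X_1,…,X_n] with {g_1,…,g_r} in general position. Let μ_0 > 0 and let x : (0,μ_0) → ℝ^n be a function such that for every μ ∈ (0,μ_0): g_i(x(μ)) > 0 for all i and ∇f(x(μ)) = μ·Σ_{i=1}^r ∇g_i(x(μ))/g_i(x(μ)). Assume x(μ) → x̄ ∈ ℝ^n as μ → 0⁺. Then, with I = {i : g_i(x̄) = 0}: if I is empty then ∇f(x̄) = 0, and otherwise ∇f(x̄) lies in the linear span of {∇g_i(x̄) : i ∈ I}; i.e., the limit x̄ is a critical point of f on the algebraic boundary S_= = {x : ∏ g_i(x) = 0} with respect to its canonical Whitney stratification. (Real-number form of the first part of the theorem on the limiting behavior of a bounded critical path.) -/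

import Mathlib

open MvPolynomial
open scoped Matrix

/-- `{g_1,…,g_r}` is in general position: at every common real zero of a subfamily, the
gradients of that subfamily are linearly independent. -/
def GeneralPosition {n r : ℕ} (g : Fin r → MvPolynomial (Fin n) ℝ) : Prop :=
  ∀ (I : Finset (Fin r)) (x : Fin n → ℝ), (∀ i ∈ I, eval x (g i) = 0) →
    LinearIndependent ℝ
      (fun i : {i // i ∈ I} => (fun j => eval x (pderiv j (g i.1)) : Fin n → ℝ))

/-- With `{g_1,…,g_r}` in general position, the limit `x̄` of a convergent
critical path of the log-barrier function is a critical point of `f` on the algebraic boundary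
`{∏ g_i = 0}` with respect to its canonical Whitney stratification: `∇f(x̄)` lies in the span
of `{∇g_i(x̄) : g_i(x̄) = 0}` (in particular `∇f(x̄) = 0` when no `g_i` vanishes at `x̄`). -/
theorem critical_path_limit_is_critical (n r : ℕ) (f : MvPolynomial (Fin n) ℝ)
    (g : Fin r → MvPolynomial (Fin n) ℝ) (hgp : GeneralPosition g)
    (μ0 : ℝ) (hμ0 : 0 < μ0) (x : ℝ → Fin n → ℝ)
    (hpath : ∀ μ ∈ Set.Ioo (0 : ℝ) μ0,
      (∀ i, 0 < eval (x μ) (g i)) ∧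
      (∀ j, eval (x μ) (pderiv j f) =
        μ * ∑ i, eval (x μ) (pderiv j (g i)) / eval (x μ) (g i)))
    (xb : Fin n → ℝ)
    (hlim : Filter.Tendsto x (nhdsWithin 0 (Set.Ioi 0)) (nhds xb)) :
    (fun j => eval xb (pderiv j f)) ∈ Submodule.span ℝ
      {v : Fin n → ℝ | ∃ i, eval xb (g i) = 0 ∧ v = fun j => eval xb (pderiv j (g i))} := by
  classical
  have hev : ∀ p : MvPolynomial (Fin n) ℝ, Filter.Tendsto (fun μ => eval (x μ) p)
      (nhdsWithin 0 (Set.Ioi 0)) (nhds (eval xb p)) := fun p =>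
    ((MvPolynomial.continuous_eval p).tendsto xb).comp hlim
  let J := {i : Fin r // i ∈ Finset.univ.filter (fun i => eval xb (g i) = 0)}
  let A : (Fin n → ℝ) → Matrix (Fin n) J ℝ := fun y => Matrix.of fun j i => eval y (pderiv j (g i.1))
  have hli : LinearIndependent ℝ (A xb).col :=
    hgp (Finset.univ.filter (fun i => eval xb (g i) = 0)) xb (by simp)
  obtain ⟨B, hB⟩ : ∃ B : Matrix J (Fin n) ℝ, B * A xb = 1 := by
    have hinj : Function.Injective (Matrix.toLin' (A xb)) := by
      have := Matrix.mulVec_injective_iff.2 hli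
      intro a b hab
      apply this
      simpa using hab
    obtain ⟨L, hL⟩ := LinearMap.exists_leftInverse_of_injective _ (LinearMap.ker_eq_bot.2 hinj)
    refine ⟨LinearMap.toMatrix' L, ?_⟩
    have := congrArg LinearMap.toMatrix' hL
    rwa [LinearMap.toMatrix'_comp, LinearMap.toMatrix'_toLin', LinearMap.toMatrix'_id] at this
  let h : ℝ → Fin n → ℝ := fun μ j => eval (x μ) (pderiv j f) -
    μ * ∑ i ∈ Finset.univ.filter (fun i => ¬ eval xb (g i) = 0),
      eval (x μ) (pderiv j (g i)) / eval (x μ) (g i)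
  have hid : Filter.Tendsto (fun μ : ℝ => μ) (nhdsWithin 0 (Set.Ioi 0)) (nhds 0) :=
    tendsto_nhdsWithin_of_tendsto_nhds Filter.tendsto_id
  have hh : Filter.Tendsto h (nhdsWithin 0 (Set.Ioi 0)) (nhds fun j => eval xb (pderiv j f)) := by
    rw [tendsto_pi_nhds]
    intro j
    have h1 := (hev (pderiv j f)).sub (hid.mul (tendsto_finsetSum
      (Finset.univ.filter (fun i => ¬ eval xb (g i) = 0))
      (fun i hi => (hev (pderiv j (g i))).div (hev (g i)) (Finset.mem_filter.1 hi).2)))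
    simpa [h] using h1
  have hA : Filter.Tendsto (fun μ => A (x μ)) (nhdsWithin 0 (Set.Ioi 0)) (nhds (A xb)) := by
    refine tendsto_pi_nhds.2 fun j => tendsto_pi_nhds.2 fun i => ?_
    exact hev _
  have key : ∀ μ ∈ Set.Ioo (0 : ℝ) μ0, A (x μ) *ᵥ ((B * A (x μ)).adjugate *ᵥ (B *ᵥ h μ)) =
      (B * A (x μ)).det • h μ := by
    intro μ hμ
    obtain ⟨hpos, heq⟩ := hpath μ hμ
    have e : h μ = A (x μ) *ᵥ (fun i : J => μ / eval (x μ) (g i.1)) := by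
      funext j
      have h2 : (A (x μ) *ᵥ (fun i : J => μ / eval (x μ) (g i.1))) j =
          ∑ i ∈ Finset.univ.filter (fun i => eval xb (g i) = 0),
            eval (x μ) (pderiv j (g i)) * (μ / eval (x μ) (g i)) :=
        by
          rw [← Finset.sum_coe_sort]
          unfold Matrix.mulVec dotProduct
          refine Finset.sum_congr ?_ fun _ _ => rfl
          refine Finset.ext fun a => iff_of_true ?_ ?_
          · exact @Finset.mem_univ _ (_) _
          · exact @Finset.mem_univ _ (_) _
      rw [h2]
      simp only [h]
      rw [heq j, ← Finset.sum_filter_add_sum_filter_not Finset.univ (fun i => eval xb (g i) = 0),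
        mul_add, add_sub_cancel_right, Finset.mul_sum]
      exact Finset.sum_congr rfl fun i _ => by ring
    rw [e]
    generalize (fun i : J => μ / eval (x μ) (g i.1)) = l
    rw [Matrix.mulVec_mulVec l B, Matrix.mulVec_mulVec l, Matrix.adjugate_mul,
      Matrix.smul_mulVec, Matrix.one_mulVec, Matrix.mulVec_smul]
  have hcont : Continuous fun p : Matrix (Fin n) J ℝ × (Fin n → ℝ) =>
      p.1 *ᵥ ((B * p.1).adjugate *ᵥ (B *ᵥ p.2)) := by
    have c1 : Continuous fun p : Matrix (Fin n) J ℝ × (Fin n → ℝ) => B * p.1 :=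
      continuous_const.matrix_mul continuous_fst
    exact continuous_fst.matrix_mulVec
      (c1.matrix_adjugate.matrix_mulVec (continuous_const.matrix_mulVec continuous_snd))
  have hcont2 : Continuous fun p : Matrix (Fin n) J ℝ × (Fin n → ℝ) => (B * p.1).det • p.2 := by
    have c1 : Continuous fun p : Matrix (Fin n) J ℝ × (Fin n → ℝ) => B * p.1 :=
      continuous_const.matrix_mul continuous_fst
    exact c1.matrix_det.smul continuous_snd
  have hp := hA.prodMk_nhds hh
  have t1 := (hcont.tendsto _).comp hp
  have t2 := (hcont2.tendsto _).comp hp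
  have hev2 : ∀ᶠ μ in nhdsWithin (0 : ℝ) (Set.Ioi 0), μ ∈ Set.Ioo (0 : ℝ) μ0 :=
    Ioo_mem_nhdsGT hμ0
  have fin := tendsto_nhds_unique_of_eventuallyEq t1 t2 (hev2.mono fun μ hμ => key μ hμ)
  simp only [hB, Matrix.det_one, one_smul] at fin
  rw [← fin]
  rw [Matrix.mulVec_eq_sum]
  refine Submodule.sum_mem _ fun i _ => ?_
  rw [op_smul_eq_smul]
  refine Submodule.smul_mem _ _ ?_
  apply Submodule.subset_span
  refine ⟨i.1, ?_, rfl⟩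
  exact (Finset.mem_filter.1 i.2).2
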